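/- Consider the bi-objective problem min (x², x) over x ≤ 0, and the transformed problem min (|x|, x) over x ≤ 0 obtained via φ(y₁, y₂) = (√y₁, y₂) on ℝ_+ × (−ℝ_+). The point x̄ = 0 is a Geoffrion properly efficient solution of the transformed problem but not of the original problem, even though φ is an ℝ²_+-transformation on ℝ_+ × (−ℝ_+). -/

import Mathlib

def Pos (p : ℕ) : Set (Fin p → ℝ) := {y | ∀ i, 0 ≤ y i}

def Efficient {α : Type*} {p : ℕ} (X : Set α) (f : α → Fin p → ℝ) (xb : α) : Prop :=
  xb ∈ X ∧ ¬ ∃ x ∈ X, (∀ i, f x i ≤ f xb i) ∧ f x ≠ f xb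

def GeoffrionProper {α : Type*} {p : ℕ} (X : Set α) (f : α → Fin p → ℝ) (xb : α) : Prop :=
  Efficient X f xb ∧ ∃ M : ℝ, 0 < M ∧ ∀ i : Fin p, ∀ x ∈ X, f x i < f xb i →
    ∃ j : Fin p, f xb j < f x j ∧ (f xb i - f x i) / (f x j - f xb j) ≤ M

def coneHull {p : ℕ} (A : Set (Fin p → ℝ)) : Set (Fin p → ℝ) :=
  {y | ∃ t : ℝ, 0 ≤ t ∧ ∃ a ∈ A, y = t • a}

def BensonProper {α : Type*} {p : ℕ} (X : Set α) (f : α → Fin p → ℝ) (xb : α) : Prop :=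
  xb ∈ X ∧
    closure (coneHull {y | ∃ x ∈ X, ∃ d ∈ Pos p, y = f x + d - f xb}) ∩ (-(Pos p)) = {0}

def HenigProper {α : Type*} {p : ℕ} (X : Set α) (f : α → Fin p → ℝ) (xb : α) : Prop :=
  xb ∈ X ∧ ∃ C : Set (Fin p → ℝ),
    Convex ℝ C ∧ (∀ t : ℝ, 0 ≤ t → ∀ c ∈ C, t • c ∈ C) ∧ (C ∩ (-C) ⊆ {0}) ∧
    (Pos p \ {0} ⊆ interior C) ∧ ((f '' X) ∩ ((fun c => f xb - c) '' C) = {f xb})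

def Cdelta (p : ℕ) (δ : ℝ) : Set (Fin p → ℝ) :=
  {y | ∀ i : Fin p, 0 ≤ y i + δ * ∑ j, y j}


theorem stmt16 :
    (∀ y ∈ {y : Fin 2 → ℝ | 0 ≤ y 0 ∧ y 1 ≤ 0},
      ∀ z ∈ {y : Fin 2 → ℝ | 0 ≤ y 0 ∧ y 1 ≤ 0},
        ((∀ i, y i ≤ z i) ↔
          (∀ i, (![Real.sqrt (y 0), y 1] : Fin 2 → ℝ) i ≤
                (![Real.sqrt (z 0), z 1] : Fin 2 → ℝ) i))) ∧
    GeoffrionProper {x : ℝ | x ≤ 0} (fun x => ![|x|, x]) 0 ∧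
    ¬ GeoffrionProper {x : ℝ | x ≤ 0} (fun x => ![x ^ 2, x]) 0 := by
  refine ⟨?_, ⟨⟨by simp, ?_⟩, 1, one_pos, ?_⟩, ?_⟩
  · rintro y - z ⟨hz, -⟩
    simp [Fin.forall_fin_two, Real.sqrt_le_sqrt_iff hz]
  · rintro ⟨x, -, hle, hne⟩
    have hx : x = 0 := by simpa using hle 0
    exact hne (by simp [hx])
  · intro i x hx hlt
    have hx : x ≤ 0 := hx
    fin_cases i
    · exact absurd hlt (by simp)
    · have hx0 : x < 0 := by simpa using hlt
      refine ⟨0, by simpa using hx0.ne, ?_⟩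
      simp [abs_of_neg hx0, div_self hx0.ne]
  · rintro ⟨-, M, hM, h⟩
    have hpos : 0 < (M + 1)⁻¹ := by positivity
    obtain ⟨j, hj, hle⟩ := h 1 (-(M + 1)⁻¹) (by simpa using hpos.le)
      (by simpa using hpos)
    fin_cases j
    · have hratio : (M + 1)⁻¹ / (M + 1)⁻¹ ^ 2 = M + 1 := by field_simp
      have : (M + 1)⁻¹ / (M + 1)⁻¹ ^ 2 ≤ M := by simpa using hle
      linarith
    · have : 0 < -(M + 1)⁻¹ := by simpa using hj
      linarith
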